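/- arXiv:2305.03929 — 2 statements merged into one kernel-verified Lean document; each statement's English description precedes it below -/
import Mathlib

section
/- Fix a state x ∈ ℝⁿ. Let h₁ : ℝⁿ → ℝ be differentiable at x with h₁(x) > 0, let β₁ > 0 and β₂ be real constants with β₂ < β₁·h₁(x), and define h₂ : ℝⁿ → ℝ by h₂(y) = −β₁·h₁(y) + β₂ (so h₂(x) < 0). Then for every extended class K∞ function α₁ there exists an extended class K∞ function α₂ such that K_{cbf,1}(x) ∩ K_{cbf,2}(x) = ∅, i.e., no input u ∈ ℝᵐ satisfying ḣ₁(x,u) ≥ −α₁(h₁(x)) also satisfies ḣ₂(x,u) ≥ −α₂(h₂(x)). (Proposition 1 of the paper, with the structure h₂ = −β₁h₁ + β₂ used in its proof.) -/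
/-- **Proposition 1.** Fix a state `x ∈ ℝⁿ` for the control-affine system
`ẋ = f(x) + g(x)u`, with `ḣ(x,u) = Dh(x)(f(x) + g(x)u)`.  Let `h₁` be
differentiable at `x` with `h₁ x > 0`, let `β₁ > 0` and `β₂ < β₁ * h₁ x`, and let
`h₂ y = -β₁ * h₁ y + β₂` (so `h₂ x < 0`).  Then for every extended class `K∞`
function `α₁` there exists an extended class `K∞` function `α₂` such that no
input `u` satisfying `ḣ₁(x,u) ≥ -α₁(h₁ x)` also satisfies
`ḣ₂(x,u) ≥ -α₂(h₂ x)`, i.e. `K_cbf,1(x) ∩ K_cbf,2(x) = ∅`. -/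
theorem proposition1 {n m : ℕ}
    (f : EuclideanSpace ℝ (Fin n) → EuclideanSpace ℝ (Fin n))
    (g : EuclideanSpace ℝ (Fin n) → (EuclideanSpace ℝ (Fin m) →L[ℝ] EuclideanSpace ℝ (Fin n)))
    (x : EuclideanSpace ℝ (Fin n))
    (h₁ h₂ : EuclideanSpace ℝ (Fin n) → ℝ)
    (hdiff₁ : DifferentiableAt ℝ h₁ x)
    (hpos : h₁ x > 0)
    (β₁ β₂ : ℝ) (hβ₁ : β₁ > 0) (hβ₂ : β₂ < β₁ * h₁ x)
    (hh₂ : ∀ y, h₂ y = -β₁ * h₁ y + β₂)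
    (α₁ : ℝ → ℝ)
    (hα₁ : StrictMono α₁ ∧ α₁ 0 = 0 ∧ Function.Surjective α₁) :
    ∃ α₂ : ℝ → ℝ,
      (StrictMono α₂ ∧ α₂ 0 = 0 ∧ Function.Surjective α₂) ∧
      ∀ u : EuclideanSpace ℝ (Fin m),
        fderiv ℝ h₁ x (f x + g x u) ≥ -α₁ (h₁ x) →
        ¬ (fderiv ℝ h₂ x (f x + g x u) ≥ -α₂ (h₂ x)) := by
  have hα₁pos : 0 < α₁ (h₁ x) := hα₁.2.1 ▸ hα₁.1 hpos
  have hneg : h₂ x < 0 := by rw [hh₂]; linarith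
  have hderiv : HasFDerivAt h₂ (-β₁ • fderiv ℝ h₁ x) x := by
    rw [funext hh₂]
    exact (hdiff₁.hasFDerivAt.const_mul (-β₁)).add_const β₂
  have hk : 0 < (β₁ * α₁ (h₁ x) + 1) / -h₂ x := div_pos (by positivity) (neg_pos.2 hneg)
  refine ⟨fun s => (β₁ * α₁ (h₁ x) + 1) / -h₂ x * s,
    ⟨fun a b hab => mul_lt_mul_of_pos_left hab hk, mul_zero _,
      mul_left_surjective₀ hk.ne'⟩, fun u hu hu₂ => ?_⟩
  have hval : (β₁ * α₁ (h₁ x) + 1) / -h₂ x * h₂ x = -(β₁ * α₁ (h₁ x) + 1) := by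
    have := hneg.ne
    field_simp
  rw [hderiv.fderiv, smul_apply, smul_eq_mul] at hu₂
  simp only [hval] at hu₂
  linarith [mul_le_mul_of_nonneg_left hu hβ₁.le]
end

section
/- Fix a state x ∈ ℝⁿ, functions h₁, h₂ : ℝⁿ → ℝ differentiable at x, and functions α₁, α₂ : ℝ → ℝ. If the linear functional u ↦ Dh₁(x)(g(x)u) on ℝᵐ is nonzero, then the Relaxed-CBF-QP feasible set is nonempty: there exist u ∈ ℝᵐ and δ ≥ 0 such that ḣ₁(x,u) ≥ −α₁(h₁(x)) and ḣ₂(x,u) ≥ −α₂(h₂(x)) − δ. (Feasibility guarantee for R-CBF-QP claimed in the paper's contributions.) -/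
/-- **Feasibility of the Relaxed-CBF-QP.**  Fix a state `x ∈ ℝⁿ`, functions
`h₁, h₂` differentiable at `x`, and `α₁, α₂ : ℝ → ℝ`.  If the linear
functional `u ↦ Dh₁(x)(g(x)u)` on `ℝᵐ` is nonzero, then the R-CBF-QP feasible
set is nonempty: there exist `u ∈ ℝᵐ` and `δ ≥ 0` with
`ḣ₁(x,u) ≥ -α₁(h₁ x)` and `ḣ₂(x,u) ≥ -α₂(h₂ x) - δ`. -/
theorem rcbfqp_feasible {n m : ℕ}
    (f : EuclideanSpace ℝ (Fin n) → EuclideanSpace ℝ (Fin n))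
    (g : EuclideanSpace ℝ (Fin n) → (EuclideanSpace ℝ (Fin m) →L[ℝ] EuclideanSpace ℝ (Fin n)))
    (x : EuclideanSpace ℝ (Fin n))
    (h₁ h₂ : EuclideanSpace ℝ (Fin n) → ℝ)
    (hdiff₁ : DifferentiableAt ℝ h₁ x)
    (hdiff₂ : DifferentiableAt ℝ h₂ x)
    (α₁ α₂ : ℝ → ℝ)
    (hnz : (fderiv ℝ h₁ x).comp (g x) ≠ 0) :
    ∃ (u : EuclideanSpace ℝ (Fin m)) (δ : ℝ), δ ≥ 0 ∧
      fderiv ℝ h₁ x (f x + g x u) ≥ -α₁ (h₁ x) ∧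
      fderiv ℝ h₂ x (f x + g x u) ≥ -α₂ (h₂ x) - δ := by
  obtain ⟨v, hv⟩ : ∃ v, fderiv ℝ h₁ x (g x v) ≠ 0 := by
    by_contra! h
    exact hnz (ContinuousLinearMap.ext h)
  set u := ((-α₁ (h₁ x) - fderiv ℝ h₁ x (f x)) / fderiv ℝ h₁ x (g x v)) • v with hu
  refine ⟨u, max 0 (-α₂ (h₂ x) - fderiv ℝ h₂ x (f x + g x u)), le_max_left _ _, ?_, ?_⟩
  · rw [hu, map_add, map_smul, map_smul, smul_eq_mul, div_mul_cancel₀ _ hv]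
    linarith
  · linarith [le_max_right 0 (-α₂ (h₂ x) - fderiv ℝ h₂ x (f x + g x u))]
end
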